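/- arXiv:1107.3359 — 2 statements merged into one kernel-verified Lean document; each statement's English description precedes it below -/
import Mathlib

section
/- Let 1 ≤ s ≤ r+1 ≤ n with n ≥ 2, p = r − s + 1, S' = K[x_1,…,x_r], S'' = K[x_s,…,x_n], S = K[x_1,…,x_n], and let I ⊂ S' and J ⊂ S'' be monomial ideals. Then sdepth_S(IS ∩ JS) ≥ sdepth_{S'}(I) + sdepth_{S''}(J) − p = sdepth_S(IS) + sdepth_S(JS) − n. -/
open MvPolynomial

/-- The `K`-subspace `m·K[Z]` of `S = K[x_0,…,x_{n-1}]`, where `m` is the monomial with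
exponent vector `a` and `Z` is a set of variables: the span of all monomials `m·w`
with `w` a monomial in the variables of `Z`. -/
noncomputable def StanleySpace (K : Type*) [Field K] {n : ℕ} (a : Fin n →₀ ℕ)
    (Z : Finset (Fin n)) : Submodule K (MvPolynomial (Fin n) K) :=
  Submodule.span K
    {p | ∃ c : Fin n →₀ ℕ, c.support ⊆ Z ∧ p = monomial (a + c) (1 : K)}

/-- `I` is a monomial ideal, i.e. an ideal generated by monomials. -/
def IsMonomialIdeal {K : Type*} [Field K] {n : ℕ}
    (I : Ideal (MvPolynomial (Fin n) K)) : Prop :=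
  ∃ G : Set (Fin n →₀ ℕ), I = Ideal.span ((fun a => monomial a (1 : K)) '' G)

/-- The `K`-subspace of `S` spanned by the monomials lying in `I` but not in `J`.
For monomial ideals `J ⊆ I` this is the canonical `K`-vector space representative
of the `ℤⁿ`-graded module `I/J` inside `S`. -/
noncomputable def monomialSpan (K : Type*) [Field K] {n : ℕ}
    (I J : Ideal (MvPolynomial (Fin n) K)) : Submodule K (MvPolynomial (Fin n) K) :=
  Submodule.span K
    {p | ∃ a : Fin n →₀ ℕ, p = monomial a (1 : K) ∧
      monomial a (1 : K) ∈ I ∧ monomial a (1 : K) ∉ J}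

/-- The family `(a i, Z i), i = 1,…,r` is a Stanley decomposition of the module `I/J`
(represented by the span of the monomials of `I \ J`): the Stanley spaces
`(a i)·K[Z i]` are independent and their (direct) sum is all of `I/J`. -/
def IsStanleyDecomp (K : Type*) [Field K] {n r : ℕ}
    (I J : Ideal (MvPolynomial (Fin n) K))
    (a : Fin r → (Fin n →₀ ℕ)) (Z : Fin r → Finset (Fin n)) : Prop :=
  iSupIndep (fun i => StanleySpace K (a i) (Z i)) ∧
    (⨆ i, StanleySpace K (a i) (Z i)) = monomialSpan K I J

/-- The Stanley depth `sdepth_S (I/J)` of the module `I/J`, where `J ⊆ I ⊆ S` are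
monomial ideals: the largest `d` such that there is a Stanley decomposition of `I/J`
all of whose Stanley spaces use at least `d` variables.  (As `ℕ∞`: the Stanley depth
of the zero module, which admits the empty decomposition, is `⊤`.)
`sdepth K I ⊥` is `sdepth_S I` and `sdepth K ⊤ I` is `sdepth_S (S/I)`. -/
noncomputable def sdepth (K : Type*) [Field K] {n : ℕ}
    (I J : Ideal (MvPolynomial (Fin n) K)) : ℕ∞ :=
  sSup {d : ℕ∞ | ∃ (r : ℕ) (a : Fin r → (Fin n →₀ ℕ)) (Z : Fin r → Finset (Fin n)),
    IsStanleyDecomp K I J a Z ∧ ∀ i, d ≤ ((Z i).card : ℕ∞)}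

/-- The depth `depth_S M` of an `S`-module `M` with respect to the maximal graded
ideal `(x_0,…,x_{n-1})`: the supremum of the lengths of `M`-regular sequences
contained in that ideal. -/
noncomputable def gradedDepth (K : Type*) [Field K] (n : ℕ) (M : Type*)
    [AddCommGroup M] [Module (MvPolynomial (Fin n) K) M] : ℕ∞ :=
  sSup {k : ℕ∞ | ∃ rs : List (MvPolynomial (Fin n) K), (rs.length : ℕ∞) = k ∧
    (∀ x ∈ rs, x ∈ Ideal.span (Set.range (X : Fin n → MvPolynomial (Fin n) K))) ∧
    RingTheory.Sequence.IsRegular M rs}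

/-- Extension of an ideal along an inclusion of polynomial rings induced by a map
of variables (`IS`, for `f` injective). -/
noncomputable def extIdeal {K : Type*} [Field K] {m n : ℕ} (f : Fin m → Fin n)
    (I : Ideal (MvPolynomial (Fin m) K)) : Ideal (MvPolynomial (Fin n) K) :=
  Ideal.map (rename f : MvPolynomial (Fin m) K →ₐ[K] MvPolynomial (Fin n) K) I

/-- The inclusion of the variables of `S'' = K[x_{r+1},…,x_n]` into those of
`S = K[x_1,…,x_n]` (variables indexed from `0`). -/
def sndEmbed {n r : ℕ} (h : r ≤ n) : Fin (n - r) → Fin n :=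
  fun i => ⟨r + i.1, by have := i.2; omega⟩

/-- The inclusion of the variables of `S'' = K[x_s,…,x_n]` into those of
`S = K[x_1,…,x_n]` (variables indexed from `0`). -/
def midEmbed {n s : ℕ} (hs : 1 ≤ s) (hsn : s ≤ n) : Fin (n + 1 - s) → Fin n :=
  fun i => ⟨s - 1 + i.1, by have := i.2; omega⟩

/-- The exponent vectors of the monomials in the Stanley space `x^a K[Z]`. -/
def stanleyBox {n : ℕ} (a : Fin n →₀ ℕ) (Z : Finset (Fin n)) : Set (Fin n →₀ ℕ) :=
  {b | ∀ i, a i ≤ b i ∧ (i ∉ Z → b i = a i)}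

/-- The set `U` of exponent vectors is a finite disjoint union of Stanley boxes, each of
dimension at least `d`. -/
def HasBoxPartition {n : ℕ} (d : ℕ∞) (U : Set (Fin n →₀ ℕ)) : Prop :=
  ∃ (r : ℕ) (a : Fin r → (Fin n →₀ ℕ)) (Z : Fin r → Finset (Fin n)),
    (Pairwise fun i j => Disjoint (stanleyBox (a i) (Z i)) (stanleyBox (a j) (Z j))) ∧
    (⋃ i, stanleyBox (a i) (Z i)) = U ∧ ∀ i, d ≤ ((Z i).card : ℕ∞)

/-- The exponent vectors of the monomials of an ideal. -/
def exponentSet {K : Type*} [Field K] {n : ℕ} (I : Ideal (MvPolynomial (Fin n) K)) :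
    Set (Fin n →₀ ℕ) :=
  {a | monomial a (1 : K) ∈ I}

theorem HasBoxPartition.of_finite {n : ℕ} {d : ℕ∞} {U : Set (Fin n →₀ ℕ)} {ι : Type*} [Finite ι]
    (a : ι → (Fin n →₀ ℕ)) (Z : ι → Finset (Fin n))
    (hdisj : ∀ i j b, b ∈ stanleyBox (a i) (Z i) → b ∈ stanleyBox (a j) (Z j) → i = j)
    (hU : ∀ b, b ∈ U ↔ ∃ i, b ∈ stanleyBox (a i) (Z i))
    (hd : ∀ i, d ≤ ((Z i).card : ℕ∞)) : HasBoxPartition d U := by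
  obtain ⟨r, ⟨e⟩⟩ := Finite.exists_equiv_fin ι
  refine ⟨r, a ∘ e.symm, Z ∘ e.symm, fun i j hij => ?_, ?_, fun i => hd _⟩
  · exact Set.disjoint_left.mpr fun b hb hb' => hij (e.symm.injective (hdisj _ _ b hb hb'))
  · ext b
    rw [hU, Set.mem_iUnion]
    exact e.symm.surjective.exists (p := fun i => b ∈ stanleyBox (a i) (Z i)) |>.symm

theorem HasBoxPartition.exists_disjoint_cover {n : ℕ} {d : ℕ∞} {U : Set (Fin n →₀ ℕ)}
    (h : HasBoxPartition d U) :
    ∃ (r : ℕ) (a : Fin r → (Fin n →₀ ℕ)) (Z : Fin r → Finset (Fin n)),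
      (∀ i j b, b ∈ stanleyBox (a i) (Z i) → b ∈ stanleyBox (a j) (Z j) → i = j) ∧
      (∀ b, b ∈ U ↔ ∃ i, b ∈ stanleyBox (a i) (Z i)) ∧ ∀ i, d ≤ ((Z i).card : ℕ∞) := by
  obtain ⟨r, a, Z, h₁, rfl, h₃⟩ := h
  refine ⟨r, a, Z, fun i j b hi hj => ?_, fun b => Set.mem_iUnion, h₃⟩
  by_contra hij
  exact Set.disjoint_left.mp (h₁ hij) hi hj

theorem stanleySpace_eq_restrictSupport (K : Type*) [Field K] {n : ℕ} (a : Fin n →₀ ℕ)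
    (Z : Finset (Fin n)) : StanleySpace K a Z = restrictSupport K (stanleyBox a Z) := by
  rw [StanleySpace, restrictSupport_eq_span]
  congr 1
  ext p
  constructor
  · rintro ⟨c, hc, rfl⟩
    refine ⟨a + c, fun i => ⟨by simp, fun hi => ?_⟩, rfl⟩
    have : c i = 0 := by
      by_contra h
      exact hi (hc (Finsupp.mem_support_iff.mpr h))
    simp [this]
  · rintro ⟨b, hb, rfl⟩
    refine ⟨b - a, fun i hi => ?_, ?_⟩
    · by_contra hZ
      simp [(hb i).2 hZ] at hi
    · rw [add_tsub_cancel_of_le (fun i => (hb i).1)]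

theorem monomialSpan_bot_eq_restrictSupport (K : Type*) [Field K] {n : ℕ}
    (I : Ideal (MvPolynomial (Fin n) K)) :
    monomialSpan K I ⊥ = restrictSupport K (exponentSet I) := by
  rw [monomialSpan, restrictSupport_eq_span]
  congr 1
  ext p
  constructor
  · rintro ⟨a, rfl, ha, -⟩
    exact ⟨a, ha, rfl⟩
  · rintro ⟨a, ha, rfl⟩
    exact ⟨a, rfl, ha, by simp⟩

theorem iSup_restrictSupport (K : Type*) [Field K] {n : ℕ} {ι : Sort*}
    (s : ι → Set (Fin n →₀ ℕ)) :
    ⨆ i, restrictSupport K (s i) = restrictSupport K (⋃ i, s i) := by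
  simp_rw [restrictSupport_eq_span, Set.image_iUnion, Submodule.span_iUnion]

theorem restrictSupport_inj (K : Type*) [Field K] {n : ℕ} {s t : Set (Fin n →₀ ℕ)} :
    restrictSupport K s = restrictSupport K t ↔ s = t := by
  refine ⟨fun h => ?_, fun h => h ▸ rfl⟩
  ext a
  have := SetLike.ext_iff.mp h (monomial a 1)
  simpa [monomial_mem_restrictSupport] using this

theorem disjoint_restrictSupport_iff (K : Type*) [Field K] {n : ℕ} {s t : Set (Fin n →₀ ℕ)} :
    Disjoint (restrictSupport K s) (restrictSupport K t) ↔ Disjoint s t := by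
  rw [Submodule.disjoint_def, Set.disjoint_left]
  constructor
  · intro h a has hat
    have := h (monomial a 1) ((monomial_mem_restrictSupport K).mpr (.inl has))
      ((monomial_mem_restrictSupport K).mpr (.inl hat))
    simp at this
  · intro h p hs ht
    rw [mem_restrictSupport_iff] at hs ht
    rw [← support_eq_empty, Finset.eq_empty_iff_forall_notMem]
    exact fun a ha => h (hs ha) (ht ha)

theorem isStanleyDecomp_bot_iff (K : Type*) [Field K] {n r : ℕ}
    (I : Ideal (MvPolynomial (Fin n) K)) (a : Fin r → (Fin n →₀ ℕ))
    (Z : Fin r → Finset (Fin n)) :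
    IsStanleyDecomp K I ⊥ a Z ↔
      (Pairwise fun i j => Disjoint (stanleyBox (a i) (Z i)) (stanleyBox (a j) (Z j))) ∧
      (⋃ i, stanleyBox (a i) (Z i)) = exponentSet I := by
  simp_rw [IsStanleyDecomp, iSupIndep, stanleySpace_eq_restrictSupport,
    monomialSpan_bot_eq_restrictSupport, iSup_restrictSupport, restrictSupport_inj,
    disjoint_restrictSupport_iff, Set.disjoint_iUnion_right]
  exact and_congr_left fun _ => ⟨fun h i j hij => h i j hij.symm, fun h i j hij => h hij.symm⟩

theorem sdepth_bot_eq_sSup (K : Type*) [Field K] {n : ℕ} (I : Ideal (MvPolynomial (Fin n) K)) :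
    sdepth K I ⊥ = sSup {d : ℕ∞ | HasBoxPartition d (exponentSet I)} := by
  simp_rw [sdepth, isStanleyDecomp_bot_iff, HasBoxPartition, and_assoc]

theorem mem_exponentSet_span {K : Type*} [Field K] {n : ℕ} {G : Set (Fin n →₀ ℕ)}
    {a : Fin n →₀ ℕ} :
    a ∈ exponentSet (Ideal.span ((fun a => monomial a (1 : K)) '' G)) ↔ ∃ g ∈ G, g ≤ a := by
  classical
  simp [exponentSet, mem_ideal_span_monomial_image, support_monomial]

theorem extIdeal_span_monomial {K : Type*} [Field K] {m n : ℕ} (f : Fin m → Fin n)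
    (G : Set (Fin m →₀ ℕ)) :
    extIdeal f (Ideal.span ((fun a => monomial a (1 : K)) '' G)) =
      Ideal.span ((fun a => monomial a (1 : K)) '' (Finsupp.mapDomain f '' G)) := by
  rw [extIdeal, Ideal.map_span, Set.image_image, Set.image_image]
  simp [rename_monomial]

theorem mem_exponentSet_extIdeal {K : Type*} [Field K] {m n : ℕ} {f : Fin m → Fin n}
    (hf : Function.Injective f) {I : Ideal (MvPolynomial (Fin m) K)} (hI : IsMonomialIdeal I)
    (b : Fin n →₀ ℕ) :
    b ∈ exponentSet (extIdeal f I) ↔ b.comapDomain f hf.injOn ∈ exponentSet I := by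
  obtain ⟨G, rfl⟩ := hI
  rw [extIdeal_span_monomial, mem_exponentSet_span, mem_exponentSet_span, Set.exists_mem_image]
  refine exists_congr fun g => and_congr_right fun _ => ⟨fun h i => ?_, fun h j => ?_⟩
  · simpa [Finsupp.mapDomain_apply hf] using h (f i)
  · by_cases hj : j ∈ Set.range f
    · obtain ⟨i, rfl⟩ := hj
      simpa [Finsupp.mapDomain_apply hf] using h i
    · simp [Finsupp.mapDomain_of_notMem_range _ _ hj]

theorem IsMonomialIdeal.extIdeal {K : Type*} [Field K] {m n : ℕ} (f : Fin m → Fin n)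
    {I : Ideal (MvPolynomial (Fin m) K)} (hI : IsMonomialIdeal I) :
    IsMonomialIdeal (extIdeal f I) := by
  obtain ⟨G, rfl⟩ := hI
  exact ⟨Finsupp.mapDomain f '' G, extIdeal_span_monomial f G⟩

/-- The monomials of a monomial ideal can be classified by their truncation at a common
multiple of finitely many generators, which yields a Stanley decomposition. -/
theorem IsMonomialIdeal.hasBoxPartition_zero {K : Type*} [Field K] {n : ℕ}
    {I : Ideal (MvPolynomial (Fin n) K)} (hI : IsMonomialIdeal I) :
    HasBoxPartition 0 (exponentSet I) := by
  classical
  obtain ⟨G, rfl⟩ := hI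
  obtain ⟨T, hTG, hT⟩ := (Submodule.fg_span_iff_fg_span_finset_subset
    (R := MvPolynomial (Fin n) K) ((fun a => monomial a (1 : K)) '' G)).mp (IsNoetherian.noetherian _)
  obtain ⟨F, -, rfl⟩ := Finset.subset_set_image_iff.mp hTG
  rw [Finset.coe_image] at hT
  have hspan : Ideal.span ((fun a => monomial a (1 : K)) '' G) =
    Ideal.span ((fun a => monomial a (1 : K)) '' (F : Set (Fin n →₀ ℕ))) := hT
  rw [hspan]
  set U := exponentSet (Ideal.span ((fun a => monomial a (1 : K)) '' (F : Set (Fin n →₀ ℕ))))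
  set g := F.sup id
  have hg : ∀ x ∈ F, x ≤ g := fun x hx => Finset.le_sup (f := id) hx
  have hU : ∀ b, b ∈ U ↔ b ⊓ g ∈ U := fun b => by
    simp only [U, mem_exponentSet_span, le_inf_iff]
    exact exists_congr fun x => ⟨fun h => ⟨h.1, h.2, hg x h.1⟩, fun h => ⟨h.1, h.2.1⟩⟩
  have key : ∀ a ≤ g, ∀ b,
      b ∈ stanleyBox a (Finset.univ.filter fun i => a i = g i) ↔ b ⊓ g = a := by
    intro a ha b
    simp only [stanleyBox, Set.mem_ofPred_eq, DFunLike.ext_iff, Finsupp.inf_apply]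
    refine forall_congr' fun i => ?_
    have := ha i
    simp only [Finset.mem_filter, Finset.mem_univ, true_and]
    grind
  have : Finite {a : Fin n →₀ ℕ // a ≤ g ∧ a ∈ U} :=
    ((Set.finite_Iic g).subset fun _ h => h.1 : {a | a ≤ g ∧ a ∈ U}.Finite).to_subtype
  refine HasBoxPartition.of_finite (ι := {a : Fin n →₀ ℕ // a ≤ g ∧ a ∈ U}) (fun a => a.1)
    (fun a => Finset.univ.filter fun i => a.1 i = g i) ?_ ?_ (fun _ => zero_le)
  · rintro ⟨a, ha, _⟩ ⟨a', ha', _⟩ b hb hb'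
    exact Subtype.ext (((key a ha b).mp hb).symm.trans ((key a' ha' b).mp hb'))
  · intro b
    rw [hU]
    constructor
    · exact fun h => ⟨⟨b ⊓ g, inf_le_right, h⟩, (key _ inf_le_right b).mpr rfl⟩
    · rintro ⟨⟨a, ha, haU⟩, hb⟩
      rwa [(key a ha b).mp hb]

theorem HasBoxPartition.inter {n : ℕ} {d e : ℕ∞} {U V : Set (Fin n →₀ ℕ)}
    (hU : HasBoxPartition d U) (hV : HasBoxPartition e V) :
    HasBoxPartition (d + e - n) (U ∩ V) := by
  obtain ⟨r, a, Z, hdisj, hmem, hd⟩ := hU.exists_disjoint_cover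
  obtain ⟨t, a', Z', hdisj', hmem', he⟩ := hV.exists_disjoint_cover
  have key : ∀ p : {p : Fin r × Fin t //
      (stanleyBox (a p.1) (Z p.1) ∩ stanleyBox (a' p.2) (Z' p.2)).Nonempty}, ∀ b,
      b ∈ stanleyBox (a p.1.1 ⊔ a' p.1.2) (Z p.1.1 ∩ Z' p.1.2) ↔
        b ∈ stanleyBox (a p.1.1) (Z p.1.1) ∧ b ∈ stanleyBox (a' p.1.2) (Z' p.1.2) := by
    rintro ⟨⟨i, j⟩, w, hw, hw'⟩ b
    simp only [stanleyBox, Set.mem_ofPred_eq] at hw hw' ⊢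
    rw [← forall_and]
    refine forall_congr' fun k => ?_
    have h₁ := hw k
    have h₂ := hw' k
    simp only [Finsupp.sup_apply, Finset.mem_inter]
    grind
  refine HasBoxPartition.of_finite (hdisj := fun p q b hp hq => ?_) (hU := fun b => ?_) (hd := fun p => ?_)
    (ι := {p : Fin r × Fin t //
      (stanleyBox (a p.1) (Z p.1) ∩ stanleyBox (a' p.2) (Z' p.2)).Nonempty})
    (a := fun p => a p.1.1 ⊔ a' p.1.2) (Z := fun p => Z p.1.1 ∩ Z' p.1.2)
  · rw [key] at hp hq
    exact Subtype.ext (Prod.ext (hdisj _ _ b hp.1 hq.1) (hdisj' _ _ b hp.2 hq.2))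
  · simp_rw [key]
    rw [Set.mem_inter_iff, hmem, hmem']
    constructor
    · rintro ⟨⟨i, hi⟩, j, hj⟩
      exact ⟨⟨(i, j), b, hi, hj⟩, hi, hj⟩
    · rintro ⟨p, hi, hj⟩
      exact ⟨⟨_, hi⟩, _, hj⟩
  · rw [tsub_le_iff_right]
    refine (add_le_add (hd p.1.1) (he p.1.2)).trans ?_
    have h₁ := Finset.card_union_add_card_inter (Z p.1.1) (Z' p.1.2)
    have h₂ := Finset.card_le_univ (Z p.1.1 ∪ Z' p.1.2)
    rw [Fintype.card_fin] at h₂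
    norm_cast
    omega

theorem HasBoxPartition.preimage_comapDomain {m n : ℕ} {f : Fin m → Fin n}
    (hf : Function.Injective f) {d : ℕ∞} {U : Set (Fin m →₀ ℕ)} (hU : HasBoxPartition d U) :
    HasBoxPartition (d + (n - m : ℕ)) {b : Fin n →₀ ℕ | b.comapDomain f hf.injOn ∈ U} := by
  classical
  obtain ⟨r, a, Z, hdisj, hmem, hd⟩ := hU.exists_disjoint_cover
  have key : ∀ i b, b ∈ stanleyBox ((a i).mapDomain f)
        ((Z i).image f ∪ (Finset.univ.image f)ᶜ) ↔
      b.comapDomain f hf.injOn ∈ stanleyBox (a i) (Z i) := by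
    intro i b
    simp only [stanleyBox, Set.mem_ofPred_eq, Finsupp.comapDomain_apply]
    constructor
    · intro h k
      simpa [Finsupp.mapDomain_apply hf, hf.eq_iff] using h (f k)
    · intro h k
      by_cases hk : k ∈ Set.range f
      · obtain ⟨k, rfl⟩ := hk
        simpa [Finsupp.mapDomain_apply hf, hf.eq_iff] using h k
      · rw [Finsupp.mapDomain_of_notMem_range _ _ hk]
        simp_all
  refine HasBoxPartition.of_finite (hdisj := fun i j b hi hj => ?_) (hU := fun b => ?_) (hd := fun i => ?_)
    (a := fun i => (a i).mapDomain f)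
    (Z := fun i => (Z i).image f ∪ (Finset.univ.image f)ᶜ)
  · rw [key] at hi hj
    exact hdisj _ _ _ hi hj
  · simp_rw [key]
    exact hmem _
  · refine (add_le_add_left (hd i) _).trans ?_
    rw [Finset.card_union_of_disjoint, Finset.card_compl, Finset.card_image_of_injective _ hf,
      Finset.card_image_of_injective _ hf]
    · simp
    · exact (disjoint_compl_right (a := Finset.univ.image f)).mono_left
        (Finset.image_subset_image (Finset.subset_univ _))

theorem HasBoxPartition.of_preimage_comapDomain {m n : ℕ} {f : Fin m → Fin n}
    (hf : Function.Injective f) {d : ℕ∞} {U : Set (Fin m →₀ ℕ)}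
    (hU : HasBoxPartition d {b : Fin n →₀ ℕ | b.comapDomain f hf.injOn ∈ U}) :
    HasBoxPartition (d - (n - m : ℕ)) U := by
  classical
  obtain ⟨r, a, Z, hdisj, hmem, hd⟩ := hU.exists_disjoint_cover
  have key : ∀ i, (∀ k ∉ Set.range f, a i k = 0) → ∀ x : Fin m →₀ ℕ,
      x ∈ stanleyBox ((a i).comapDomain f hf.injOn) (Finset.univ.filter fun k => f k ∈ Z i) ↔
      x.mapDomain f ∈ stanleyBox (a i) (Z i) := by
    intro i hi x
    simp only [stanleyBox, Set.mem_ofPred_eq, Finsupp.comapDomain_apply]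
    constructor
    · intro h k
      by_cases hk : k ∈ Set.range f
      · obtain ⟨k, rfl⟩ := hk
        simpa [Finsupp.mapDomain_apply hf] using h k
      · simp [Finsupp.mapDomain_of_notMem_range _ _ hk, hi k hk]
    · intro h k
      simpa [Finsupp.mapDomain_apply hf] using h (f k)
  refine HasBoxPartition.of_finite (hdisj := fun i j x hi hj => ?_) (hU := fun x => ?_) (hd := fun i => ?_)
    (ι := {i // ∀ k ∉ Set.range f, a i k = 0})
    (a := fun i => (a i.1).comapDomain f hf.injOn)
    (Z := fun i => Finset.univ.filter fun k => f k ∈ Z i.1)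
  · rw [key _ i.2] at hi
    rw [key _ j.2] at hj
    exact Subtype.ext (hdisj _ _ _ hi hj)
  · have hx := hmem (x.mapDomain f)
    rw [Set.mem_ofPred_eq, Finsupp.comapDomain_mapDomain f hf] at hx
    rw [hx]
    constructor
    · rintro ⟨i, hi⟩
      have h0 : ∀ k ∉ Set.range f, a i k = 0 := fun k hk => by
        have := (hi k).1
        rwa [Finsupp.mapDomain_of_notMem_range _ _ hk, Nat.le_zero] at this
      exact ⟨⟨i, h0⟩, (key i h0 x).mpr hi⟩
    · rintro ⟨i, hi⟩
      exact ⟨i, (key _ i.2 x).mp hi⟩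
  · rw [tsub_le_iff_right]
    refine (hd i.1).trans ?_
    have hsub : Z i.1 ⊆
        (Finset.univ.filter fun k => f k ∈ Z i.1).image f ∪ (Finset.univ.image f)ᶜ := by
      intro k hk
      by_cases hkf : k ∈ Finset.univ.image f
      · obtain ⟨k, -, rfl⟩ := Finset.mem_image.mp hkf
        exact Finset.mem_union_left _ (Finset.mem_image_of_mem f (by simpa using hk))
      · exact Finset.mem_union_right _ (Finset.mem_compl.mpr hkf)
    have hcard := (Finset.card_le_card hsub).trans (Finset.card_union_le _ _)
    rw [Finset.card_compl, Finset.card_image_of_injective _ hf,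
      Finset.card_image_of_injective _ hf, Finset.card_univ, Fintype.card_fin,
      Fintype.card_fin] at hcard
    exact_mod_cast hcard

/-- Adding variables to the ambient polynomial ring raises the Stanley depth of a monomial
ideal by the number of new variables. -/
theorem sdepth_extIdeal {K : Type*} [Field K] {m n : ℕ} {f : Fin m → Fin n}
    (hf : Function.Injective f) {I : Ideal (MvPolynomial (Fin m) K)} (hI : IsMonomialIdeal I) :
    sdepth K (extIdeal f I) ⊥ = sdepth K I ⊥ + (n - m : ℕ) := by
  have hset : exponentSet (extIdeal f I) =
      {b : Fin n →₀ ℕ | b.comapDomain f hf.injOn ∈ exponentSet I} :=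
    Set.ext fun b => mem_exponentSet_extIdeal hf hI b
  rw [sdepth_bot_eq_sSup, sdepth_bot_eq_sSup, hset]
  apply le_antisymm
  · refine sSup_le fun d hd => ?_
    rw [← tsub_le_iff_right]
    exact le_sSup (HasBoxPartition.of_preimage_comapDomain hf hd)
  · rw [ENat.sSup_add ⟨0, hI.hasBoxPartition_zero⟩]
    exact iSup₂_le fun d hd => le_sSup (HasBoxPartition.preimage_comapDomain hf hd)

theorem sdepth_add_sdepth_sub_le_sdepth_inf {K : Type*} [Field K] {n : ℕ}
    {I J : Ideal (MvPolynomial (Fin n) K)} (hI : IsMonomialIdeal I) (hJ : IsMonomialIdeal J) :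
    sdepth K I ⊥ + sdepth K J ⊥ - n ≤ sdepth K (I ⊓ J) ⊥ := by
  rw [tsub_le_iff_right, sdepth_bot_eq_sSup, sdepth_bot_eq_sSup K J, sSup_eq_iSup, sSup_eq_iSup]
  refine ENat.biSup_add_biSup_le ⟨0, hI.hasBoxPartition_zero⟩ ⟨0, hJ.hasBoxPartition_zero⟩
    fun d hd e he => ?_
  rw [← tsub_le_iff_right, sdepth_bot_eq_sSup]
  exact le_sSup (HasBoxPartition.inter hd he)

/-- Let `1 ≤ s ≤ r+1 ≤ n`, `n ≥ 2`, `p = r - s + 1`,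
`S' = K[x_1,…,x_r]`, `S'' = K[x_s,…,x_n]`, and `I ⊂ S'`, `J ⊂ S''` monomial ideals.
Then `sdepth_S(IS ∩ JS) ≥ sdepth_{S'}(I) + sdepth_{S''}(J) - p
= sdepth_S(IS) + sdepth_S(JS) - n`. -/
theorem sdepth_inf_general {K : Type*} [Field K] {n r s : ℕ}
    (hs : 1 ≤ s) (hsr : s ≤ r + 1) (hrn : r + 1 ≤ n) (hn : 2 ≤ n)
    (I : Ideal (MvPolynomial (Fin r) K)) (J : Ideal (MvPolynomial (Fin (n + 1 - s)) K))
    (hmI : IsMonomialIdeal I) (hmJ : IsMonomialIdeal J)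
    (hI0 : I ≠ ⊥) (hI1 : I ≠ ⊤) (hJ0 : J ≠ ⊥) (hJ1 : J ≠ ⊤) :
    sdepth K (extIdeal (Fin.castLE (by omega : r ≤ n)) I ⊓
        extIdeal (midEmbed hs (by omega : s ≤ n)) J) ⊥ ≥
      sdepth K I ⊥ + sdepth K J ⊥ - ((r + 1 - s : ℕ) : ℕ∞) ∧
    sdepth K I ⊥ + sdepth K J ⊥ - ((r + 1 - s : ℕ) : ℕ∞) =
      sdepth K (extIdeal (Fin.castLE (by omega : r ≤ n)) I) ⊥ +
        sdepth K (extIdeal (midEmbed hs (by omega : s ≤ n)) J) ⊥ - (n : ℕ∞) := by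
  have hf : Function.Injective (Fin.castLE (by omega : r ≤ n)) := Fin.castLE_injective _
  have hg : Function.Injective (midEmbed hs (by omega : s ≤ n)) := fun i j h => by
    simp only [midEmbed, Fin.mk.injEq] at h
    omega
  have heq : sdepth K I ⊥ + sdepth K J ⊥ - ((r + 1 - s : ℕ) : ℕ∞) =
      sdepth K (extIdeal (Fin.castLE (by omega : r ≤ n)) I) ⊥ +
        sdepth K (extIdeal (midEmbed hs (by omega : s ≤ n)) J) ⊥ - (n : ℕ∞) := by
    rw [sdepth_extIdeal hf hmI, sdepth_extIdeal hg hmJ, add_add_add_comm]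
    have hn' : (n : ℕ∞) =
        (r + 1 - s : ℕ) + (((n - r : ℕ) : ℕ∞) + ((n - (n + 1 - s) : ℕ) : ℕ∞)) := by
      norm_cast
      omega
    conv_rhs => rw [hn']
    rw [tsub_add_eq_tsub_tsub_swap, AddLECancellable.add_tsub_cancel_right]
    exact ENat.addLECancellable_of_ne_top (by simp)
  exact ⟨heq ▸ sdepth_add_sdepth_sub_le_sdepth_inf (hmI.extIdeal _) (hmJ.extIdeal _), heq⟩
end

section
/- If I ⊂ S = K[x_1,…,x_n] is a monomial ideal and J = (u_1,…,u_m) ⊂ S is a monomial ideal with m minimal monomial generators, then sdepth_S(I ∩ J) ≥ sdepth_S(I) − ⌊m/2⌋, sdepth_S(I + J) ≥ min{ sdepth_S(I), sdepth_S(S/I) − ⌊m/2⌋ }, sdepth_S(S/(I + J)) ≥ sdepth_S(S/I) − m, and sdepth_S(S/(I ∩ J)) ≥ min{ sdepth_S(S/I), sdepth_S(I) − m }. -/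
open MvPolynomial

/-- The exponent vectors of the monomials in `StanleySpace K a Z`. -/
def stanleyCone {n : ℕ} (a : Fin n →₀ ℕ) (Z : Finset (Fin n)) : Set (Fin n →₀ ℕ) :=
  {x | a ≤ x ∧ ∀ i ∉ Z, x i = a i}

/-- The set `A` of exponent vectors is a finite disjoint union of Stanley cones, each with at
least `d` free directions. -/
def HasStanleyPartition {n : ℕ} (d : ℕ∞) (A : Set (Fin n →₀ ℕ)) : Prop :=
  ∃ (r : ℕ) (a : Fin r → (Fin n →₀ ℕ)) (Z : Fin r → Finset (Fin n)),
    Pairwise (Function.onFun Disjoint fun i => stanleyCone (a i) (Z i)) ∧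
      (⋃ i, stanleyCone (a i) (Z i)) = A ∧ ∀ i, d ≤ ((Z i).card : ℕ∞)

/-- The exponent vectors of the monomials lying in `I` but not in `J`. -/
def monomialExponents {K : Type*} [Field K] {n : ℕ} (I J : Ideal (MvPolynomial (Fin n) K)) :
    Set (Fin n →₀ ℕ) :=
  {a | monomial a (1 : K) ∈ I ∧ monomial a (1 : K) ∉ J}

theorem stanleyCone_inter {n : ℕ} {a b : Fin n →₀ ℕ} {Z W : Finset (Fin n)}
    (h : (stanleyCone a Z ∩ stanleyCone b W).Nonempty) :
    stanleyCone a Z ∩ stanleyCone b W = stanleyCone (a ⊔ b) (Z ∩ W) := by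
  obtain ⟨y, ⟨hay, hyZ⟩, hby, hyW⟩ := h
  ext x
  constructor
  · rintro ⟨⟨hax, hxZ⟩, hbx, hxW⟩
    refine ⟨sup_le hax hbx, fun i hi => ?_⟩
    have h1 := hax i
    have h2 := hbx i
    rw [Finsupp.sup_apply]
    by_cases hiZ : i ∈ Z
    · rw [hxW i fun hiW => hi (Finset.mem_inter.2 ⟨hiZ, hiW⟩)] at h1 ⊢
      exact (sup_eq_right.2 h1).symm
    · rw [hxZ i hiZ] at h2 ⊢
      exact (sup_eq_left.2 h2).symm
  · rintro ⟨habx, hx⟩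
    refine ⟨⟨le_sup_left.trans habx, fun i hi => ?_⟩, le_sup_right.trans habx, fun i hi => ?_⟩
    · rw [hx i fun h => hi (Finset.mem_inter.1 h).1, Finsupp.sup_apply]
      exact sup_eq_left.2 (hyZ i hi ▸ hby i)
    · rw [hx i fun h => hi (Finset.mem_inter.1 h).2, Finsupp.sup_apply]
      exact sup_eq_right.2 (hyW i hi ▸ hay i)

theorem stanleyCone_univ {n : ℕ} (a : Fin n →₀ ℕ) :
    stanleyCone a Finset.univ = Set.Ici a := by
  ext x
  simp [stanleyCone]

namespace HasStanleyPartition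

variable {n : ℕ} {d e : ℕ∞} {A B : Set (Fin n →₀ ℕ)}

theorem of_fintype {ι : Type*} [Fintype ι] (a : ι → (Fin n →₀ ℕ)) (Z : ι → Finset (Fin n))
    (hdisj : ∀ i j x, x ∈ stanleyCone (a i) (Z i) → x ∈ stanleyCone (a j) (Z j) → i = j)
    (hA : ∀ x, x ∈ A ↔ ∃ i, x ∈ stanleyCone (a i) (Z i))
    (hd : ∀ i, d ≤ ((Z i).card : ℕ∞)) : HasStanleyPartition d A := by
  let f := (Fintype.equivFin ι).symm
  refine ⟨Fintype.card ι, a ∘ f, Z ∘ f, fun i j hij => Set.disjoint_left.2 fun x hi hj =>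
    hij (f.injective (hdisj _ _ x hi hj)), ?_, fun i => hd _⟩
  ext x
  rw [Set.mem_iUnion, hA]
  exact f.exists_congr_left.trans (by simp)

theorem mono (h : HasStanleyPartition e A) (hd : d ≤ e) : HasStanleyPartition d A := by
  obtain ⟨r, a, Z, h1, h2, h3⟩ := h
  exact ⟨r, a, Z, h1, h2, fun i => hd.trans (h3 i)⟩

theorem empty : HasStanleyPartition d (∅ : Set (Fin n →₀ ℕ)) :=
  of_fintype (ι := Empty) (fun i => i.elim) (fun i => i.elim) (fun i => i.elim) (by simp)
    (fun i => i.elim)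

theorem Ici (u : Fin n →₀ ℕ) : HasStanleyPartition n (Set.Ici u) :=
  of_fintype (ι := Unit) (fun _ => u) (fun _ => Finset.univ) (fun _ _ _ _ _ => rfl)
    (by simp [stanleyCone_univ]) (by simp)

theorem union (hA : HasStanleyPartition d A) (hB : HasStanleyPartition d B)
    (hAB : Disjoint A B) : HasStanleyPartition d (A ∪ B) := by
  obtain ⟨r, a, Z, h1, rfl, h3⟩ := hA
  obtain ⟨s, b, W, h4, rfl, h6⟩ := hB
  rw [Set.disjoint_left] at hAB
  refine of_fintype (ι := Fin r ⊕ Fin s) (Sum.elim a b) (Sum.elim Z W) ?_ ?_ ?_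
  · rintro (i | i) (j | j) x hi hj
    · exact congrArg _ (h1.eq (Set.not_disjoint_iff.2 ⟨x, hi, hj⟩))
    · exact (hAB (Set.mem_iUnion.2 ⟨i, hi⟩) (Set.mem_iUnion.2 ⟨j, hj⟩)).elim
    · exact (hAB (Set.mem_iUnion.2 ⟨j, hj⟩) (Set.mem_iUnion.2 ⟨i, hi⟩)).elim
    · exact congrArg _ (h4.eq (Set.not_disjoint_iff.2 ⟨x, hi, hj⟩))
  · simp
  · rintro (i | i)
    exacts [h3 i, h6 i]

theorem inter {c : ℕ} (hA : HasStanleyPartition d A)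
    (hB : HasStanleyPartition ((n - c : ℕ) : ℕ∞) B) :
    HasStanleyPartition (d - c) (A ∩ B) := by
  classical
  obtain ⟨r, a, Z, h1, rfl, h3⟩ := hA
  obtain ⟨s, b, W, h4, rfl, h6⟩ := hB
  let ι := {p : Fin r × Fin s //
    (stanleyCone (a p.1) (Z p.1) ∩ stanleyCone (b p.2) (W p.2)).Nonempty}
  refine of_fintype (ι := ι) (fun p => a p.1.1 ⊔ b p.1.2) (fun p => Z p.1.1 ∩ W p.1.2) ?_ ?_ ?_
  · rintro ⟨⟨i, j⟩, hp⟩ ⟨⟨i', j'⟩, hp'⟩ x hx hx'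
    dsimp only at hx hx'
    rw [← stanleyCone_inter hp] at hx
    rw [← stanleyCone_inter hp'] at hx'
    obtain rfl := h1.eq (Set.not_disjoint_iff.2 ⟨x, hx.1, hx'.1⟩)
    obtain rfl := h4.eq (Set.not_disjoint_iff.2 ⟨x, hx.2, hx'.2⟩)
    rfl
  · intro x
    constructor
    · rintro ⟨hx, hx'⟩
      obtain ⟨i, hi⟩ := Set.mem_iUnion.1 hx
      obtain ⟨j, hj⟩ := Set.mem_iUnion.1 hx'
      have hp : (stanleyCone (a i) (Z i) ∩ stanleyCone (b j) (W j)).Nonempty := ⟨x, hi, hj⟩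
      exact ⟨⟨(i, j), hp⟩, stanleyCone_inter hp ▸ ⟨hi, hj⟩⟩
    · rintro ⟨⟨⟨i, j⟩, hp⟩, hx⟩
      dsimp only at hx
      rw [← stanleyCone_inter hp] at hx
      exact ⟨Set.mem_iUnion.2 ⟨i, hx.1⟩, Set.mem_iUnion.2 ⟨j, hx.2⟩⟩
  · rintro ⟨⟨i, j⟩, -⟩
    dsimp only
    rw [tsub_le_iff_right]
    refine (h3 i).trans ?_
    have hW : n - c ≤ (W j).card := by exact_mod_cast h6 j
    have hZW := Finset.card_union_add_card_inter (Z i) (W j)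
    have hle := Finset.card_le_univ (Z i ∪ W j)
    rw [Fintype.card_fin] at hle
    have : (Z i).card ≤ (Z i ∩ W j).card + c := by omega
    exact_mod_cast this

theorem inter_add {c c' : ℕ} (hA : HasStanleyPartition ((n - c : ℕ) : ℕ∞) A)
    (hB : HasStanleyPartition ((n - c' : ℕ) : ℕ∞) B) :
    HasStanleyPartition ((n - (c + c') : ℕ) : ℕ∞) (A ∩ B) := by
  have h := hA.inter hB
  rwa [← ENat.natCast_sub, Nat.sub_sub] at h

theorem Ici_compl (u : Fin n →₀ ℕ) :
    HasStanleyPartition ((n - 1 : ℕ) : ℕ∞) (Set.Ici u)ᶜ := by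
  classical
  let a : (Σ i : Fin n, Fin (u i)) → (Fin n →₀ ℕ) := fun p =>
    Finsupp.equivFunOnFinite.symm fun j => if j < p.1 then u j else if j = p.1 then p.2 else 0
  have ha : ∀ (p : Σ i : Fin n, Fin (u i)) (x : Fin n →₀ ℕ),
      x ∈ stanleyCone (a p) {p.1}ᶜ ↔ (∀ j < p.1, u j ≤ x j) ∧ x p.1 = p.2 := by
    rintro ⟨i, k⟩ x
    simp only [stanleyCone, Set.mem_ofPred_eq, Finsupp.le_def, a,
      Finsupp.equivFunOnFinite_symm_apply_apply, Finset.mem_compl, Finset.mem_singleton, not_not,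
      forall_eq, lt_irrefl, if_false, if_true]
    refine and_congr_left fun hx => ⟨fun h j hj => ?_, fun h j => ?_⟩
    · simpa [hj] using h j
    · split_ifs with h1 h2
      · exact h j h1
      · rw [h2, hx]
      · exact Nat.zero_le _
  refine of_fintype a (fun p => {p.1}ᶜ) ?_ ?_ ?_
  · rintro ⟨i, k⟩ ⟨i', k'⟩ x hx hx'
    rw [ha] at hx hx'
    obtain ⟨h1, h2⟩ := hx
    obtain ⟨h3, h4⟩ := hx'
    dsimp only at h1 h2 h3 h4
    have hk := k.2
    have hk' := k'.2
    rcases lt_trichotomy i i' with h | rfl | h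
    · have := h3 i h
      omega
    · rw [Fin.ext (h2.symm.trans h4)]
    · have := h1 i' h
      omega
  · intro x
    simp only [ha, Set.mem_compl_iff, Set.mem_Ici, Finsupp.le_def, not_forall, not_le]
    constructor
    · intro h
      obtain ⟨i, hi, hmin⟩ := WellFounded.has_min (wellFounded_lt (α := Fin n))
        {i | x i < u i} h
      exact ⟨⟨i, x i, hi⟩, fun j hj => not_lt.1 fun hlt => hmin j hlt hj, rfl⟩
    · rintro ⟨⟨i, k⟩, -, hk⟩
      exact ⟨i, hk ▸ k.2⟩
  · intro p
    simp [Finset.card_compl]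

end HasStanleyPartition

/-- The exponent vectors selected by a list `u₁, u₂, …` under the rule that if `u₁` divides, one
continues with the tail, and otherwise one skips `u₁` and `u₂`; a single last entry must divide. -/
def alternatingSet {n : ℕ} : List (Fin n →₀ ℕ) → Set (Fin n →₀ ℕ)
  | [] => Set.univ
  | [u] => Set.Ici u
  | u :: v :: l => Set.Ici u ∩ alternatingSet (v :: l) ∪ (Set.Ici u)ᶜ ∩ alternatingSet l

theorem alternatingSet_compl {n : ℕ} (u v : Fin n →₀ ℕ) (l : List (Fin n →₀ ℕ)) :
    (alternatingSet (u :: v :: l))ᶜ =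
      Set.Ici u ∩ (alternatingSet (v :: l))ᶜ ∪ (Set.Ici u)ᶜ ∩ (alternatingSet l)ᶜ := by
  ext x
  simp only [alternatingSet, Set.mem_compl_iff, Set.mem_union, Set.mem_inter_iff]
  tauto

theorem hasStanleyPartition_branch {n c : ℕ} (u : Fin n →₀ ℕ) {A B : Set (Fin n →₀ ℕ)}
    (hA : HasStanleyPartition ((n - (c + 1) : ℕ) : ℕ∞) A)
    (hB : HasStanleyPartition ((n - c : ℕ) : ℕ∞) B) :
    HasStanleyPartition ((n - (c + 1) : ℕ) : ℕ∞) (Set.Ici u ∩ A ∪ (Set.Ici u)ᶜ ∩ B) := by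
  have hu : HasStanleyPartition ((n - 0 : ℕ) : ℕ∞) (Set.Ici u) := .Ici u
  have h1 := hA.inter_add hu
  have h2 := hB.inter_add (.Ici_compl u)
  rw [Set.inter_comm] at h1 h2
  refine h1.union h2 (Set.disjoint_left.2 fun x hx hx' => hx'.1 hx.1)

theorem hasStanleyPartition_alternatingSet {n : ℕ} : ∀ l : List (Fin n →₀ ℕ),
    HasStanleyPartition ((n - l.length / 2 : ℕ) : ℕ∞) (alternatingSet l) ∧
      HasStanleyPartition ((n - (l.length + 1) / 2 : ℕ) : ℕ∞) (alternatingSet l)ᶜ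
  | [] => by
    have h : HasStanleyPartition n (Set.univ : Set (Fin n →₀ ℕ)) := by
      simpa using HasStanleyPartition.Ici (0 : Fin n →₀ ℕ)
    exact ⟨by simpa [alternatingSet] using h,
      by simpa [alternatingSet] using HasStanleyPartition.empty⟩
  | [u] => ⟨by simpa [alternatingSet] using HasStanleyPartition.Ici u,
      by simpa [alternatingSet] using HasStanleyPartition.Ici_compl u⟩
  | u :: v :: l => by
    have h1 := hasStanleyPartition_alternatingSet (v :: l)
    have h2 := hasStanleyPartition_alternatingSet l
    simp only [List.length_cons] at h1 ⊢
    rw [alternatingSet_compl, show (l.length + 1 + 1) / 2 = l.length / 2 + 1 by omega,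
      show (l.length + 1 + 1 + 1) / 2 = (l.length + 1) / 2 + 1 by omega]
    refine ⟨hasStanleyPartition_branch u (h1.1.mono ?_) h2.1,
      hasStanleyPartition_branch u (h1.2.mono ?_) h2.2⟩ <;>
    · rw [Nat.cast_le]
      omega

theorem exists_le_iff_mem_alternatingSet {n : ℕ} (x : Fin n →₀ ℕ) :
    ∀ (u : Fin n →₀ ℕ) (l : List (Fin n →₀ ℕ)), Even l.length →
      ((∃ v ∈ u :: l, v ≤ x) ↔ x ∈ alternatingSet (u :: l) ∨ x ∉ alternatingSet l) ∧
        (x ∈ alternatingSet (u :: l) → x ∈ alternatingSet l)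
  | u, [], _ => by simp [alternatingSet]
  | u, [v], h => by simp at h
  | u, v :: w :: l, h => by
    have ih := exists_le_iff_mem_alternatingSet x w l (by simpa [Nat.even_add_one] using h)
    simp only [alternatingSet, List.mem_cons, exists_eq_or_imp, Set.mem_union, Set.mem_inter_iff,
      Set.mem_compl_iff, Set.mem_Ici] at ih ⊢
    grind

theorem hasStanleyPartition_of_list {n c : ℕ} (L : List (Fin n →₀ ℕ)) (hL : L.length / 2 = c) :
    HasStanleyPartition ((n - c : ℕ) : ℕ∞) {x | ∃ u ∈ L, u ≤ x} := by
  suffices h : ∀ (u : Fin n →₀ ℕ) (l : List (Fin n →₀ ℕ)), Even l.length → l.length / 2 = c →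
      HasStanleyPartition ((n - c : ℕ) : ℕ∞) {x | ∃ v ∈ u :: l, v ≤ x} by
    rcases L with _ | ⟨u, l⟩
    · simpa using HasStanleyPartition.empty
    · rw [List.length_cons] at hL
      rcases Nat.even_or_odd l.length with he | ho
      · exact h u l he (by obtain ⟨k, hk⟩ := he; omega)
      · simpa using h u (u :: l) (by simpa [Nat.even_add_one] using ho) hL
  intro u l he hc
  have heq : {x | ∃ v ∈ u :: l, v ≤ x} = alternatingSet (u :: l) ∪ (alternatingSet l)ᶜ := by
    ext x
    exact (exists_le_iff_mem_alternatingSet x u l he).1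
  rw [heq]
  obtain ⟨k, hk⟩ := he
  refine ((hasStanleyPartition_alternatingSet _).1.mono ?_).union
    ((hasStanleyPartition_alternatingSet _).2.mono ?_) (Set.disjoint_left.2 fun x hx hx' =>
      hx' ((exists_le_iff_mem_alternatingSet x u l ⟨k, hk⟩).2 hx))
  all_goals
    rw [Nat.cast_le, ← hc]
    try rw [List.length_cons]
    omega

theorem hasStanleyPartition_compl_of_list {n : ℕ} : ∀ L : List (Fin n →₀ ℕ),
    HasStanleyPartition ((n - L.length : ℕ) : ℕ∞) {x | ∃ u ∈ L, u ≤ x}ᶜ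
  | [] => by simpa using HasStanleyPartition.Ici (0 : Fin n →₀ ℕ)
  | u :: l => by
    have h := (hasStanleyPartition_compl_of_list l).inter_add (.Ici_compl u)
    have heq : {x | ∃ v ∈ u :: l, v ≤ x}ᶜ = {x | ∃ v ∈ l, v ≤ x}ᶜ ∩ (Set.Ici u)ᶜ := by
      ext x
      simp only [Set.mem_compl_iff, Set.mem_ofPred_eq, List.mem_cons, exists_eq_or_imp, not_or,
        Set.mem_inter_iff, Set.mem_Ici]
      exact and_comm
    rwa [heq]

section Translation

variable {K : Type*} [Field K] {n : ℕ}

theorem stanleySpace_eq_span_image (a : Fin n →₀ ℕ) (Z : Finset (Fin n)) :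
    StanleySpace K a Z =
      Submodule.span K (basisMonomials (Fin n) K '' stanleyCone a Z) := by
  rw [StanleySpace]
  congr 1
  ext p
  simp only [Set.mem_ofPred_eq, Set.mem_image, coe_basisMonomials]
  constructor
  · rintro ⟨c, hc, rfl⟩
    refine ⟨a + c, ⟨le_self_add, fun i hi => ?_⟩, rfl⟩
    rw [Finsupp.add_apply, Finsupp.notMem_support_iff.1 fun h => hi (hc h), add_zero]
  · rintro ⟨x, ⟨hax, hx⟩, rfl⟩
    refine ⟨x - a, fun i hi => ?_, by rw [add_tsub_cancel_of_le hax]⟩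
    by_contra hiZ
    rw [Finsupp.mem_support_iff, Finsupp.tsub_apply, hx i hiZ, tsub_self] at hi
    exact hi rfl

theorem monomialSpan_eq_span_image (I J : Ideal (MvPolynomial (Fin n) K)) :
    monomialSpan K I J =
      Submodule.span K (basisMonomials (Fin n) K '' monomialExponents I J) := by
  rw [monomialSpan]
  congr 1
  ext p
  simp [monomialExponents, and_comm, eq_comm]

theorem isStanleyDecomp_iff {r : ℕ} (I J : Ideal (MvPolynomial (Fin n) K))
    (a : Fin r → (Fin n →₀ ℕ)) (Z : Fin r → Finset (Fin n)) :
    IsStanleyDecomp K I J a Z ↔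
      Pairwise (Function.onFun Disjoint fun i => stanleyCone (a i) (Z i)) ∧
        (⋃ i, stanleyCone (a i) (Z i)) = monomialExponents I J := by
  let b := basisMonomials (Fin n) K
  simp only [IsStanleyDecomp, stanleySpace_eq_span_image, monomialSpan_eq_span_image]
  refine and_congr ⟨fun h i j hij => Set.disjoint_left.2 fun x hi hj => b.ne_zero x ?_,
    fun h i => ?_⟩ ?_
  · exact Submodule.disjoint_def.1 (h.pairwiseDisjoint hij) _
      (b.self_mem_span_image.2 hi) (b.self_mem_span_image.2 hj)
  · simp only [← Submodule.span_iUnion, ← Set.image_iUnion]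
    refine b.linearIndependent.disjoint_span_image ?_
    simp only [Set.disjoint_iUnion_right]
    exact fun j hj => h hj.symm
  · rw [← Submodule.span_iUnion, ← Set.image_iUnion]
    refine ⟨fun h => Set.ext fun x => ?_, fun h => by rw [h]⟩
    rw [← b.self_mem_span_image (R := K), h, b.self_mem_span_image]

theorem sdepth_eq_sSup (I J : Ideal (MvPolynomial (Fin n) K)) :
    sdepth K I J = sSup {d | HasStanleyPartition d (monomialExponents I J)} := by
  simp only [sdepth, HasStanleyPartition, isStanleyDecomp_iff, and_assoc]

theorem sdepth_sub_le {I J I' J' : Ideal (MvPolynomial (Fin n) K)} {c : ℕ}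
    (h : ∀ d, HasStanleyPartition d (monomialExponents I J) →
      HasStanleyPartition (d - c) (monomialExponents I' J')) :
    sdepth K I J - c ≤ sdepth K I' J' := by
  rw [tsub_le_iff_right, sdepth_eq_sSup I J]
  refine sSup_le fun d hd => ?_
  rw [← tsub_le_iff_right, sdepth_eq_sSup]
  exact le_sSup (h d hd)

theorem min_sdepth_sub_le {I J I' J' I'' J'' : Ideal (MvPolynomial (Fin n) K)} {c : ℕ}
    (h : ∀ d e, HasStanleyPartition d (monomialExponents I J) →
      HasStanleyPartition e (monomialExponents I' J') →
      HasStanleyPartition (min d (e - c)) (monomialExponents I'' J'')) :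
    min (sdepth K I J) (sdepth K I' J' - c) ≤ sdepth K I'' J'' := by
  refine le_of_forall_lt fun t ht => ?_
  obtain ⟨h1, h2⟩ := lt_min_iff.1 ht
  rw [lt_tsub_iff_right] at h2
  rw [sdepth_eq_sSup, lt_sSup_iff] at h1 h2
  obtain ⟨d, hd, htd⟩ := h1
  obtain ⟨e, he, hte⟩ := h2
  rw [sdepth_eq_sSup]
  exact (lt_min htd (lt_tsub_iff_right.2 hte)).trans_le (le_sSup (h d e hd he))

theorem monomial_mem_span_iff (G : Set (Fin n →₀ ℕ)) (x : Fin n →₀ ℕ) :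
    monomial x (1 : K) ∈ Ideal.span ((fun a => monomial a (1 : K)) '' G) ↔ ∃ u ∈ G, u ≤ x := by
  classical
  simp [mem_ideal_span_monomial_image, support_monomial]

theorem monomial_mem_sup_iff {I J : Ideal (MvPolynomial (Fin n) K)} (hI : IsMonomialIdeal I)
    (hJ : IsMonomialIdeal J) (x : Fin n →₀ ℕ) :
    monomial x (1 : K) ∈ I ⊔ J ↔ monomial x (1 : K) ∈ I ∨ monomial x (1 : K) ∈ J := by
  obtain ⟨G, rfl⟩ := hI
  obtain ⟨H, rfl⟩ := hJ
  rw [← Ideal.span_union, ← Set.image_union]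
  simp only [monomial_mem_span_iff, Set.mem_union, or_and_right, exists_or]

theorem monomialExponents_bot (I : Ideal (MvPolynomial (Fin n) K)) :
    monomialExponents I ⊥ = {x | monomial x (1 : K) ∈ I} := by
  simp [monomialExponents]

theorem monomialExponents_top (I : Ideal (MvPolynomial (Fin n) K)) :
    monomialExponents ⊤ I = {x | monomial x (1 : K) ∈ I}ᶜ := by
  ext x
  simp [monomialExponents]

end Translation

/-- Let `I ⊂ S = K[x_1,…,x_n]` be a monomial ideal and
`J = (u_1,…,u_m) ⊂ S` a monomial ideal with `m` minimal monomial generators.  Then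
`sdepth_S(I ∩ J) ≥ sdepth_S(I) - ⌊m/2⌋`,
`sdepth_S(I + J) ≥ min(sdepth_S(I), sdepth_S(S/I) - ⌊m/2⌋)`,
`sdepth_S(S/(I + J)) ≥ sdepth_S(S/I) - m`, and
`sdepth_S(S/(I ∩ J)) ≥ min(sdepth_S(S/I), sdepth_S(I) - m)`. -/
theorem sdepth_inf_sup_bounds {K : Type*} [Field K] {n m : ℕ}
    (I J : Ideal (MvPolynomial (Fin n) K))
    (hmI : IsMonomialIdeal I) (hI0 : I ≠ ⊥) (hI1 : I ≠ ⊤) (hJ0 : J ≠ ⊥) (hJ1 : J ≠ ⊤)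
    (G : Finset (Fin n →₀ ℕ)) (hGcard : G.card = m)
    (hG : J = Ideal.span ((fun a => MvPolynomial.monomial a (1 : K)) '' ↑G))
    (hmin : ∀ G' : Finset (Fin n →₀ ℕ),
      J = Ideal.span ((fun a => MvPolynomial.monomial a (1 : K)) '' ↑G') → m ≤ G'.card) :
    sdepth K (I ⊓ J) ⊥ ≥ sdepth K I ⊥ - ((m / 2 : ℕ) : ℕ∞) ∧
    sdepth K (I ⊔ J) ⊥ ≥ min (sdepth K I ⊥) (sdepth K ⊤ I - ((m / 2 : ℕ) : ℕ∞)) ∧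
    sdepth K ⊤ (I ⊔ J) ≥ sdepth K ⊤ I - (m : ℕ∞) ∧
    sdepth K ⊤ (I ⊓ J) ≥ min (sdepth K ⊤ I) (sdepth K I ⊥ - (m : ℕ∞)) := by
  have hJ : IsMonomialIdeal J := ⟨_, hG⟩
  set A : Set (Fin n →₀ ℕ) := {x | monomial x (1 : K) ∈ I} with hA
  set B : Set (Fin n →₀ ℕ) := {x | monomial x (1 : K) ∈ J} with hB
  have hinf : {x : Fin n →₀ ℕ | monomial x (1 : K) ∈ I ⊓ J} = A ∩ B := rfl
  have hsup : {x : Fin n →₀ ℕ | monomial x (1 : K) ∈ I ⊔ J} = A ∪ B :=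
    Set.ext fun x => monomial_mem_sup_iff hmI hJ x
  have hBG : B = {x | ∃ u ∈ G.toList, u ≤ x} := by
    ext x
    rw [hB, Set.mem_ofPred_eq, hG, monomial_mem_span_iff]
    simp
  have hlen : G.toList.length = m := by rw [Finset.length_toList, hGcard]
  have hB1 : HasStanleyPartition ((n - m / 2 : ℕ) : ℕ∞) B :=
    hBG ▸ hasStanleyPartition_of_list G.toList (by rw [hlen])
  have hB2 : HasStanleyPartition ((n - m : ℕ) : ℕ∞) Bᶜ := by
    rw [hBG]
    simpa only [hlen] using hasStanleyPartition_compl_of_list G.toList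
  refine ⟨sdepth_sub_le fun d hd => ?_, min_sdepth_sub_le fun d e hd he => ?_,
    sdepth_sub_le fun d hd => ?_, min_sdepth_sub_le fun d e hd he => ?_⟩ <;>
  simp only [monomialExponents_bot, monomialExponents_top, hinf, hsup, ← hA] at *
  · exact hd.inter hB1
  · rw [← Set.union_sdiff_self, Set.sdiff_eq, Set.inter_comm]
    exact (hd.mono (min_le_left _ _)).union ((he.inter hB1).mono (min_le_right _ _))
      (Set.disjoint_left.2 fun x hx hx' => hx'.1 hx)
  · rw [Set.compl_union]
    exact hd.inter hB2
  · have heq : (A ∩ B)ᶜ = Aᶜ ∪ A ∩ Bᶜ := by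
      ext x
      simp only [Set.mem_compl_iff, Set.mem_inter_iff, Set.mem_union]
      tauto
    rw [heq]
    exact (hd.mono (min_le_left _ _)).union ((he.inter hB2).mono (min_le_right _ _))
      (Set.disjoint_left.2 fun x hx hx' => hx hx'.1)
end
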